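/- For all i ∈ I₀ and a, c, d ∈ ℂˣ one has the equivalence of ℓ-weights 𝔫^{(i)}_{c,a} · 𝔴^{(i)}_{d,a} · A_{i,a}⁻¹ ≡ 𝔴^{(i)}_{dq_i⁻¹, aq_i⁻²} · ∏_{j∈I₀, j∼i} 𝔴^{(j)}_{c_{ij}⁻¹q_{ij}⁻¹, aq_{ij}⁻¹}. (This is the computation showing that the module D_i⁻ appearing in the asymptotic Baxter TQ relation is one-dimensional.) -/

import Mathlib

open scoped Classical

noncomputable section

namespace QAS

/-- ℓ-weights: an `I`-tuple (indexed by `ℕ`, only indices `1,…,M+N` are relevant) of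
rational functions together with a parity in `ℤ/2`.  The group law is componentwise
multiplication of rational functions and addition of parities. -/
abbrev LW : Type := (ℕ → RatFunc ℂ) × Multiplicative (ZMod 2)

/-- the variable `z` -/
def Z : RatFunc ℂ := RatFunc.X

/-- constant rational functions -/
def Cc (c : ℂ) : RatFunc ℂ := RatFunc.C c

/-- parity `|ε_j|` (indices are 1-based) -/
def par (M : ℕ) (j : ℕ) : ZMod 2 := if j ≤ M then 0 else 1

/-- `q_j` -/
def qq (M : ℕ) (q : ℂ) (j : ℕ) : ℂ := if j ≤ M then q else q⁻¹

/-- `(ε_j, ε_j) = ±1` -/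
def sgn (M : ℕ) (j : ℕ) : ℤ := if j ≤ M then 1 else -1

/-- `q̂_i` -/
def qhat (M : ℕ) (q : ℂ) (i : ℕ) : ℂ := if i = M then q⁻¹ else qq M q i

/-- `τ_i` -/
def tau (M N : ℕ) (q : ℂ) (i : ℕ) : ℂ :=
  if i ≤ M then q ^ ((M : ℤ) - N + 1 - i) else q ^ ((i : ℤ) - M + 1 - N)

/-- `θ_j` -/
def theta (M N : ℕ) (q : ℂ) (j : ℕ) : ℂ :=
  if j ≤ M then q ^ (2 * ((M : ℤ) - N + 1 - j)) else q ^ (2 * ((j : ℤ) - M - N))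

/-- `(ε_k, ε_l)` -/
def epsPair (M : ℕ) (k l : ℕ) : ℤ := if k = l then sgn M k else 0

/-- `(α_i, α_j)` where `α_i = ε_i - ε_{i+1}` -/
def alphaPair (M : ℕ) (i j : ℕ) : ℤ :=
  epsPair M i j - epsPair M i (j + 1) - epsPair M (i + 1) j + epsPair M (i + 1) (j + 1)

/-- the set of `j ∈ I₀` with `j ∼ i`, i.e. `|i - j| = 1` -/
def nbr (M N : ℕ) (i : ℕ) : Finset ℕ :=
  (Finset.Icc 1 (M + N - 1)).filter fun j => j + 1 = i ∨ j = i + 1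

/-- the ℓ-weight `⬜j_a` -/
def box (M N : ℕ) (q : ℂ) (j : ℕ) (a : ℂ) : LW :=
  (fun k => if k = j then
      Cc (qq M q j) * (1 - Cc (a * (theta M N q j)⁻¹ * (qq M q j)⁻¹) * Z) /
        (1 - Cc (a * (theta M N q j)⁻¹ * qq M q j) * Z)
    else 1,
   Multiplicative.ofAdd (par M j))

/-- the generalized simple root `A_{i,a}` -/
def Amat (M N : ℕ) (q : ℂ) (i : ℕ) (a : ℂ) : LW :=
  (fun k =>
    if k = i then
      Cc (qq M q i) *
        (1 - Cc (a * tau M N q i * q⁻¹ * (theta M N q i)⁻¹ * (qq M q i)⁻¹) * Z) /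
        (1 - Cc (a * tau M N q i * q⁻¹ * (theta M N q i)⁻¹ * qq M q i) * Z)
    else if k = i + 1 then
      Cc (qq M q (i + 1))⁻¹ *
        (1 - Cc (a * tau M N q i * q⁻¹ * (theta M N q i)⁻¹ * qq M q i * qq M q (i + 1) ^ 2) * Z) /
        (1 - Cc (a * tau M N q i * q⁻¹ * (theta M N q i)⁻¹ * qq M q i) * Z)
    else 1,
   Multiplicative.ofAdd (par M i + par M (i + 1)))

/-- the prefundamental ℓ-weight `Ψ_{i,a}` -/
def Psi (M N : ℕ) (q : ℂ) (i : ℕ) (a : ℂ) : LW :=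
  (fun k =>
    if i ≤ M then (if 1 ≤ k ∧ k ≤ i then 1 - Cc (a * (tau M N q i)⁻¹) * Z else 1)
    else (if i < k ∧ k ≤ M + N then (1 - Cc (a * (tau M N q i)⁻¹) * Z)⁻¹ else 1),
   1)

/-- the ℓ-weight `[a]_i` -/
def bra (M N : ℕ) (i : ℕ) (a : ℂ) : LW :=
  (fun k =>
    if i ≤ M then (if 1 ≤ k ∧ k ≤ i then Cc a else 1)
    else (if i < k ∧ k ≤ M + N then Cc a⁻¹ else 1),
   1)

/-- the ℓ-weight `𝔴^{(i)}_{c,a} = [c]_i Ψ_{i,ac⁻²} Ψ_{i,a}⁻¹` -/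
def wAsym (M N : ℕ) (q : ℂ) (i : ℕ) (c a : ℂ) : LW :=
  bra M N i c * Psi M N q i (a * (c ^ 2)⁻¹) * (Psi M N q i a)⁻¹

/-- the ℓ-weight `𝔫^{(i)}_{c,a}` -/
def nAsym (M N : ℕ) (q : ℂ) (i : ℕ) (c a : ℂ) : LW :=
  wAsym M N q i (qhat M q i) (a * qhat M q i ^ 2) *
    ∏ j ∈ nbr M N i, wAsym M N q j ((c ^ alphaPair M i j)⁻¹) (a * q ^ alphaPair M i j)

/-- a scalar rational function viewed as an ℓ-weight (all relevant components equal to it,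
parity `0̄`) -/
def scalarLW (M N : ℕ) (h : RatFunc ℂ) : LW :=
  (fun k => if 1 ≤ k ∧ k ≤ M + N then h else 1, 1)

/-- equivalence of ℓ-weights: `f ≡ g` iff `f g⁻¹ = ((h p_1, …, h p_κ); s)` with `h`
regular and nonvanishing at `z = 0` and `p_k ∈ ℂˣ` -/
def lequiv (M N : ℕ) (f g : LW) : Prop :=
  ∃ h : RatFunc ℂ, Polynomial.eval 0 h.denom ≠ 0 ∧ Polynomial.eval 0 h.num ≠ 0 ∧
    ∃ p : ℕ → ℂ, ∀ k, 1 ≤ k → k ≤ M + N → p k ≠ 0 ∧ f.1 k * (g.1 k)⁻¹ = h * Cc (p k)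

/-- substitution `z ↦ cz` in a rational function -/
def scaleVar (c : ℂ) (f : RatFunc ℂ) : RatFunc ℂ :=
  Polynomial.eval₂ (RatFunc.C : ℂ →+* RatFunc ℂ) (Cc c * Z) f.num /
    Polynomial.eval₂ (RatFunc.C : ℂ →+* RatFunc ℂ) (Cc c * Z) f.denom

/-- `C_i(f)(z) = ∏_{j=i}^{κ} f_j(zθ_j)^{(ε_j,ε_j)}` -/
def CFun (M N : ℕ) (q : ℂ) (i : ℕ) (f : LW) : RatFunc ℂ :=
  ∏ j ∈ Finset.Icc i (M + N), scaleVar (theta M N q j) (f.1 j) ^ sgn M j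

/-- `t_1 = θ_1` and `t_i = τ_{i-1}² q⁻²` for `i > 1` -/
def tSmall (M N : ℕ) (q : ℂ) (i : ℕ) : ℂ :=
  if i = 1 then theta M N q 1 else tau M N q (i - 1) ^ 2 * (q ^ 2)⁻¹

/-- the ℓ-weights `⬜j*_a`, defined by `⬜1*_a = (⬜1_{aθ_1})⁻¹` and
`⬜(i+1)*_a = ⬜i*_a · A_{i, aτ_i q⁻¹}` -/
def boxStar (M N : ℕ) (q : ℂ) : ℕ → ℂ → LW
  | 0, _ => 1
  | 1, a => (box M N q 1 (a * theta M N q 1))⁻¹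
  | i + 2, a => boxStar M N q (i + 1) a * Amat M N q (i + 1) (a * tau M N q (i + 1) * q⁻¹)

/-- auxiliary downwards recursion for `⬜j′_a`; the argument is `κ - j` -/
def boxPrimeAux (M N : ℕ) (q : ℂ) (a : ℂ) : ℕ → LW
  | 0 => (box M N q (M + N) a)⁻¹
  | d + 1 => boxPrimeAux M N q a d *
      (Amat M N q (M + N - (d + 1)) (a * tau M N q (M + N - (d + 1)) * q⁻¹))⁻¹

/-- the ℓ-weights `⬜j′_a`, defined by `⬜κ′_a = (⬜κ_a)⁻¹` and
`⬜(i+1)′_a = ⬜i′_a · A_{i, aτ_i q⁻¹}` -/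
def boxPrime (M N : ℕ) (q : ℂ) (j : ℕ) (a : ℂ) : LW := boxPrimeAux M N q a (M + N - j)

/-- `q^λ` as an ℓ-weight, for `λ ∈ ℤ^I` -/
def qpow (M N : ℕ) (q : ℂ) (lam : ℕ → ℤ) : LW :=
  (fun k => if 1 ≤ k ∧ k ≤ M + N then Cc (q ^ (lam k * sgn M k)) else 1,
   Multiplicative.ofAdd
     (((∑ k ∈ Finset.Icc 1 (M + N), if k ≤ M then (0 : ℤ) else lam k) : ZMod 2)))

/-- the fundamental weight `ϖ_i` for `i ≤ M` -/
def varpi (i : ℕ) : ℕ → ℤ := fun k => if 1 ≤ k ∧ k ≤ i then 1 else 0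

/-- `Y_{i,a}` for `i ≤ M` -/
def YLW (M N : ℕ) (q : ℂ) (i : ℕ) (a : ℂ) : LW :=
  qpow M N q (varpi i) * Psi M N q i (a * (qq M q i)⁻¹) * (Psi M N q i (a * qq M q i))⁻¹

/-- `ϖ^{(i)}_{m,a}` for `i ≤ M` -/
def varpiLW (M N : ℕ) (q : ℂ) (i m : ℕ) (a : ℂ) : LW :=
  qpow M N q (fun k => (m : ℤ) * varpi i k) *
    Psi M N q i (a * qq M q i ^ (1 - 2 * (m : ℤ))) * (Psi M N q i (a * qq M q i))⁻¹

/-- the submonoid `ℒ𝒬⁻` generated by the `A_{j,b}⁻¹` -/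
def LQneg (M N : ℕ) (q : ℂ) : Submonoid LW :=
  Submonoid.closure
    {w | ∃ j : ℕ, ∃ b : ℂ, 1 ≤ j ∧ j ≤ M + N - 1 ∧ b ≠ 0 ∧ w = (Amat M N q j b)⁻¹}

/-- `λ ∈ 𝒫` (1-based coordinates; `λ_j = 0` outside `1,…,M+N`) -/
def inP (M N : ℕ) (lam : ℕ → ℕ) : Prop :=
  lam 0 = 0 ∧ (∀ j, M + N < j → lam j = 0) ∧
  (∀ k l, 1 ≤ k → k ≤ l → l ≤ M → lam l ≤ lam k) ∧
  (∀ k l, M + 1 ≤ k → k ≤ l → l ≤ M + N → lam l ≤ lam k) ∧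
  (∀ j, 1 ≤ j → j ≤ N → 0 < lam (M + j) → j ≤ lam M)

/-- the Young diagram `Y₊^λ ⊂ ℤ_{>0}²` -/
def Yp (M N : ℕ) (lam : ℕ → ℕ) : Set (ℕ × ℕ) :=
  {p | 1 ≤ p.1 ∧ 1 ≤ p.2 ∧
    ((p.1 ≤ M ∧ p.2 ≤ lam p.1) ∨ (M < p.1 ∧ p.2 ≤ N ∧ p.1 ≤ M + lam (M + p.2)))}

/-- `Y₋^λ = -Y₊^λ ⊂ ℤ_{<0}²` -/
def YnZ (M N : ℕ) (lam : ℕ → ℕ) : Set (ℤ × ℤ) :=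
  {p | ∃ k l : ℕ, (k, l) ∈ Yp M N lam ∧ p = (-(k : ℤ), -(l : ℤ))}

/-- tableau conditions on a domain `Y ⊂ ℤ²`, with entries in `{1,…,kap}` and the
strictness threshold `MM` (tableaux are encoded as functions `ℤ × ℤ → ℕ`
vanishing off `Y`) -/
def isTab (MM kap : ℕ) (Y : Set (ℤ × ℤ)) (T : ℤ × ℤ → ℕ) : Prop :=
  (∀ p, p ∉ Y → T p = 0) ∧
  (∀ p ∈ Y, 1 ≤ T p ∧ T p ≤ kap) ∧
  (∀ p ∈ Y, ∀ p' ∈ Y, p.1 ≤ p'.1 → p.2 ≤ p'.2 → T p ≤ T p') ∧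
  (∀ p ∈ Y, (p.1 + 1, p.2) ∈ Y → T p ≤ MM → T p < T (p.1 + 1, p.2)) ∧
  (∀ p ∈ Y, (p.1, p.2 + 1) ∈ Y → MM < T p → T p < T (p.1, p.2 + 1))

/-- the set of tableaux `ℬ₋(λ)` -/
def Bneg (M N : ℕ) (lam : ℕ → ℕ) : Set (ℤ × ℤ → ℕ) :=
  {T | isTab M (M + N) (YnZ M N lam) T}

/-- `mϖ_j`: the first `j` coordinates equal `m`, the others vanish -/
def wt (j m : ℕ) : ℕ → ℕ := fun k => if 1 ≤ k ∧ k ≤ j then m else 0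

/-- `m_T = ∏_{k=1}^{i} ∏_{l=1}^{m} ⬜T(-k,-l)_{aτ_i q^{2(k-l)}}` for `T ∈ ℬ₋(mϖ_i)` -/
def mTab (M N : ℕ) (q : ℂ) (i m : ℕ) (a : ℂ) (T : ℤ × ℤ → ℕ) : LW :=
  ∏ k ∈ Finset.Icc 1 i, ∏ l ∈ Finset.Icc 1 m,
    box M N q (T (-(k : ℤ), -(l : ℤ))) (a * tau M N q i * q ^ (2 * ((k : ℤ) - l)))

/-- the highest tableau `H ∈ ℬ₋(mϖ_i)`, `H(-k,-l) = i + 1 - k` -/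
def Htab (i m : ℕ) : ℤ × ℤ → ℕ := fun p =>
  if 1 ≤ -p.1 ∧ -p.1 ≤ (i : ℤ) ∧ 1 ≤ -p.2 ∧ -p.2 ≤ (m : ℤ) then i + 1 - (-p.1).toNat else 0

/-- `m_T = ∏_{(i,j) ∈ Y₋^λ} ⬜T(i,j)_{aq^{2(j-i)+1}}` for `T ∈ ℬ₋(λ)`, written as a
product over a bounding rectangle of the Young diagram -/
def mTgen (M N : ℕ) (q : ℂ) (lam : ℕ → ℕ) (a : ℂ) (T : ℤ × ℤ → ℕ) : LW :=
  ∏ k ∈ Finset.Icc 1 (M + lam (M + 1)), ∏ l ∈ Finset.Icc 1 (max (lam 1) N),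
    if (k, l) ∈ Yp M N lam then
      box M N q (T (-(k : ℤ), -(l : ℤ))) (a * q ^ (2 * ((k : ℤ) - l) + 1))
    else 1

/-- the normalization factor `f^{(i)}_{c,a}(z)` -/
def fRF (M N : ℕ) (q : ℂ) (i : ℕ) (c a : ℂ) : RatFunc ℂ :=
  if i ≤ M then 1 - Cc (a * q ^ ((M : ℤ) - N - i - 1)) * Z
  else (1 - Cc (a * (c ^ 2)⁻¹ * q ^ ((M : ℤ) + N - i - 1)) * Z) *
      (1 - Cc (a * q ^ ((i : ℤ) - M - N - 1)) * Z) /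
      (1 - Cc (a * q ^ ((M : ℤ) + N - i - 1)) * Z)


/-- the linear factor `1 - uz` -/
def lin (u : ℂ) : RatFunc ℂ := 1 - Cc u * Z

lemma lin_eq_algebraMap (u : ℂ) :
    lin u = algebraMap (Polynomial ℂ) (RatFunc ℂ) (1 - Polynomial.C u * Polynomial.X) := by
  simp [lin, Cc, Z, RatFunc.algebraMap_C, RatFunc.algebraMap_X]

lemma one_sub_C_mul_X_ne_zero (u : ℂ) : (1 - Polynomial.C u * Polynomial.X : Polynomial ℂ) ≠ 0 := by
  intro h
  simpa using congrArg (Polynomial.eval 0) h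

lemma lin_ne_zero (u : ℂ) : lin u ≠ 0 := by
  rw [lin_eq_algebraMap]
  exact RatFunc.algebraMap_ne_zero (one_sub_C_mul_X_ne_zero u)

lemma eval_zero_denom_lin_div_lin (u v : ℂ) :
    Polynomial.eval 0 (lin u / lin v).denom ≠ 0 := by
  rw [lin_eq_algebraMap, lin_eq_algebraMap]
  intro h
  simpa using Polynomial.eval_eq_zero_of_dvd_of_eval_eq_zero (RatFunc.denom_div_dvd _ _) h

lemma eval_zero_num_lin_div_lin (u v : ℂ) :
    Polynomial.eval 0 (lin u / lin v).num ≠ 0 := by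
  rw [lin_eq_algebraMap, lin_eq_algebraMap]
  intro h
  simpa using Polynomial.eval_eq_zero_of_dvd_of_eval_eq_zero
    (RatFunc.num_div_dvd _ (one_sub_C_mul_X_ne_zero v)) h

/-- equality of rational functions up to a nonzero constant -/
def EqUpToConst (f g : RatFunc ℂ) : Prop := ∃ p : ℂ, p ≠ 0 ∧ f = g * Cc p

namespace EqUpToConst

variable {f g f' g' : RatFunc ℂ}

lemma refl (f : RatFunc ℂ) : EqUpToConst f f := ⟨1, one_ne_zero, by simp [Cc]⟩

lemma const_mul {c : ℂ} (hc : c ≠ 0) (f : RatFunc ℂ) : EqUpToConst (Cc c * f) f :=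
  ⟨c, hc, mul_comm _ _⟩

lemma mul (h : EqUpToConst f g) (h' : EqUpToConst f' g') : EqUpToConst (f * f') (g * g') := by
  obtain ⟨p, hp, rfl⟩ := h
  obtain ⟨p', hp', rfl⟩ := h'
  exact ⟨p * p', mul_ne_zero hp hp', by simp only [Cc, map_mul]; ring⟩

lemma inv (h : EqUpToConst f g) : EqUpToConst f⁻¹ g⁻¹ := by
  obtain ⟨p, hp, rfl⟩ := h
  exact ⟨p⁻¹, inv_ne_zero hp, by simp only [Cc, map_inv₀, mul_inv]⟩

lemma prod {ι : Type*} (s : Finset ι) {F G : ι → RatFunc ℂ}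
    (h : ∀ j ∈ s, EqUpToConst (F j) (G j)) : EqUpToConst (∏ j ∈ s, F j) (∏ j ∈ s, G j) := by
  classical
  induction s using Finset.induction_on with
  | empty => simpa using refl 1
  | insert j s hj ih =>
    rw [Finset.prod_insert hj, Finset.prod_insert hj]
    exact (h j (by simp)).mul (ih fun l hl => h l (by simp [hl]))

end EqUpToConst

lemma lequiv_of_eqUpToConst {M N : ℕ} {f g : LW} (u v : ℂ)
    (H : ∀ k, 1 ≤ k → k ≤ M + N → EqUpToConst (f.1 k * (g.1 k)⁻¹) (lin u / lin v)) :
    lequiv M N f g := by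
  refine ⟨lin u / lin v, eval_zero_denom_lin_div_lin u v, eval_zero_num_lin_div_lin u v, ?_⟩
  choose! p hp using H
  exact ⟨p, fun k h1 h2 => hp k h1 h2⟩

/-- the `k`-th component of an ℓ-weight of the form of `Ψ_j`, built from the factor `f` -/
def shape (M N j k : ℕ) (f : RatFunc ℂ) : RatFunc ℂ :=
  if j ≤ M then (if 1 ≤ k ∧ k ≤ j then f else 1) else (if j < k ∧ k ≤ M + N then f⁻¹ else 1)

lemma Psi_fst (M N : ℕ) (q : ℂ) (j : ℕ) (u : ℂ) (k : ℕ) :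
    (Psi M N q j u).1 k = shape M N j k (lin (u * (tau M N q j)⁻¹)) := rfl

lemma shape_div (M N j k : ℕ) (f g : RatFunc ℂ) :
    shape M N j k (f / g) = shape M N j k f * (shape M N j k g)⁻¹ := by
  unfold shape
  split_ifs <;> simp [div_eq_mul_inv, mul_comm]

lemma shape_ne_zero (M N j k : ℕ) {f : RatFunc ℂ} (hf : f ≠ 0) : shape M N j k f ≠ 0 := by
  unfold shape
  split_ifs <;> simp [hf]

lemma wAsym_fst_eqUpToConst (M N : ℕ) (q : ℂ) (j : ℕ) {c : ℂ} (hc : c ≠ 0) (a : ℂ) (k : ℕ) :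
    EqUpToConst ((wAsym M N q j c a).1 k)
      ((Psi M N q j (a * (c ^ 2)⁻¹)).1 k * ((Psi M N q j a).1 k)⁻¹) := by
  change EqUpToConst ((bra M N j c).1 k * _ * _) _
  rw [mul_assoc]
  simp only [bra]
  split_ifs
  · exact .const_mul hc _
  · rw [one_mul]; exact .refl _
  · exact .const_mul (inv_ne_zero hc) _
  · rw [one_mul]; exact .refl _

lemma wAsym_div_wAsym_eqUpToConst (M N : ℕ) (q : ℂ) (j : ℕ) {c c' a a' : ℂ} (hc : c ≠ 0)
    (hc' : c' ≠ 0) (h : a * (c ^ 2)⁻¹ = a' * (c' ^ 2)⁻¹) (k : ℕ) :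
    EqUpToConst ((wAsym M N q j c a).1 k * ((wAsym M N q j c' a').1 k)⁻¹)
      (shape M N j k (lin (a' * (tau M N q j)⁻¹) / lin (a * (tau M N q j)⁻¹))) := by
  have key := (wAsym_fst_eqUpToConst M N q j hc a k).mul
    (wAsym_fst_eqUpToConst M N q j hc' a' k).inv
  convert key using 1
  rw [h, shape_div]
  simp only [Psi_fst]
  rw [mul_inv, inv_inv, mul_mul_mul_comm,
    mul_inv_cancel₀ (shape_ne_zero M N j k (lin_ne_zero _)), one_mul, mul_comm]

lemma qq_ne_zero {q : ℂ} (hq : q ≠ 0) (M j : ℕ) : qq M q j ≠ 0 := by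
  unfold qq
  split_ifs <;> simp [hq]

lemma qhat_ne_zero {q : ℂ} (hq : q ≠ 0) (M j : ℕ) : qhat M q j ≠ 0 := by
  unfold qhat
  split_ifs <;> simp [hq, qq_ne_zero]

lemma tau_ne_zero {q : ℂ} (hq : q ≠ 0) (M N j : ℕ) : tau M N q j ≠ 0 := by
  unfold tau
  split_ifs <;> exact zpow_ne_zero _ hq

lemma tau_eq_tau_succ_mul {q : ℂ} (hq : q ≠ 0) (M N n : ℕ) :
    tau M N q n = tau M N q (n + 1) * qq M q (n + 1) := by
  unfold tau qq
  rcases lt_trichotomy n M with h | rfl | h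
  · rw [if_pos h.le, if_pos (by omega), if_pos (by omega), ← zpow_add_one₀ hq]
    congr 1; push_cast; ring
  · rw [if_pos le_rfl, if_neg (by omega), if_neg (by omega), ← zpow_sub_one₀ hq]
    congr 1; push_cast; ring
  · rw [if_neg (by omega), if_neg (by omega), if_neg (by omega), ← zpow_sub_one₀ hq]
    congr 1; push_cast; ring

lemma tau_mul_inv_theta {q : ℂ} (hq : q ≠ 0) (M N i : ℕ) :
    tau M N q i * q⁻¹ * (theta M N q i)⁻¹ = (tau M N q i)⁻¹ * (qq M q i)⁻¹ := by
  unfold tau theta qq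
  split_ifs
  · simp only [← zpow_neg_one, ← zpow_mul, ← zpow_add₀ hq]
    congr 1; ring
  · simp only [← zpow_neg_one, ← zpow_mul, ← zpow_add₀ hq]
    congr 1; ring

lemma alphaPair_succ_self (M n : ℕ) : alphaPair M (n + 1) n = -sgn M (n + 1) := by
  unfold alphaPair epsPair
  split_ifs <;> omega

lemma alphaPair_self_succ (M i : ℕ) : alphaPair M i (i + 1) = -sgn M (i + 1) := by
  unfold alphaPair epsPair
  split_ifs <;> omega

lemma zpow_neg_sgn (M : ℕ) (q : ℂ) (j : ℕ) : q ^ (-sgn M j) = (qq M q j)⁻¹ := by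
  unfold sgn qq
  split_ifs <;> simp

lemma prod_nbr_succ {M N n : ℕ} (hn : n + 1 ≤ M + N - 1) (g : ℕ → RatFunc ℂ) (h0 : g 0 = 1)
    (hlast : g (M + N) = 1) : ∏ j ∈ nbr M N (n + 1), g j = g n * g (n + 2) := by
  have hsub : nbr M N (n + 1) ⊆ {n, n + 2} := by
    intro j
    simp only [nbr, Finset.mem_filter, Finset.mem_Icc, Finset.mem_insert, Finset.mem_singleton]
    omega
  rw [Finset.prod_subset hsub, Finset.prod_pair (by omega)]
  intro j hj hj'
  simp only [nbr, Finset.mem_filter, Finset.mem_Icc, Finset.mem_insert,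
    Finset.mem_singleton] at hj hj'
  rcases (by omega : j = 0 ∨ j = M + N) with rfl | rfl
  exacts [h0, hlast]

lemma Amat_fst_eqUpToConst (M N : ℕ) {q : ℂ} (hq : q ≠ 0) (i : ℕ) (a : ℂ) (k : ℕ) :
    EqUpToConst ((Amat M N q i a).1 k)
      (if k = i then
        lin (a * (tau M N q i)⁻¹ * (qq M q i ^ 2)⁻¹) / lin (a * (tau M N q i)⁻¹)
      else if k = i + 1 then
        lin (a * (tau M N q i)⁻¹ * qq M q (i + 1) ^ 2) / lin (a * (tau M N q i)⁻¹)
      else 1) := by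
  have hqq := qq_ne_zero hq M i
  have e : a * tau M N q i * q⁻¹ * (theta M N q i)⁻¹ =
      a * (tau M N q i)⁻¹ * (qq M q i)⁻¹ := by
    rw [mul_assoc a, mul_assoc a, tau_mul_inv_theta hq, mul_assoc]
  have e1 : a * (tau M N q i)⁻¹ * (qq M q i)⁻¹ * qq M q i = a * (tau M N q i)⁻¹ := by
    rw [mul_assoc _ _ (qq M q i), inv_mul_cancel₀ hqq, mul_one]
  have e2 : a * (tau M N q i)⁻¹ * (qq M q i)⁻¹ * (qq M q i)⁻¹ =
      a * (tau M N q i)⁻¹ * (qq M q i ^ 2)⁻¹ := by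
    rw [mul_assoc _ (qq M q i)⁻¹, sq, mul_inv]
  simp only [Amat, e, e1, e2]
  split_ifs
  · rw [mul_div_assoc]; exact .const_mul hqq _
  · rw [mul_div_assoc]; exact .const_mul (inv_ne_zero (qq_ne_zero hq M _)) _
  · exact .refl _

lemma shape_mul_shape_mul_shape {M N n k : ℕ} (hk : 1 ≤ k) (hk' : k ≤ M + N)
    {x y v w : RatFunc ℂ} (hx : x ≠ 0) (hy : y ≠ 0) (hw : w ≠ 0)
    (hv : v = if n + 1 = M then y else w) (hwy : n + 1 = M → w = y) :
    shape M N (n + 1) k (y / v) * (shape M N n k (x / y) * shape M N (n + 2) k (w / x)) *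
      (if k = n + 1 then y / x else if k = n + 2 then w / x else 1)⁻¹ =
    if n + 1 = M ∨ n = M then x / y else 1 := by
  have hv0 : v ≠ 0 := by rw [hv]; split_ifs <;> assumption
  rcases lt_trichotomy (n + 1) M with h | h | h
  · rw [if_neg (by omega)] at hv
    subst hv
    simp only [shape, if_pos (show n + 1 ≤ M by omega), if_pos (show n ≤ M by omega),
      if_pos (show n + 2 ≤ M by omega), if_neg (show ¬(n + 1 = M ∨ n = M) by omega)]
    split_ifs <;> first | omega | field_simp
  · rw [if_pos h] at hv
    have := hwy h
    subst hv this
    simp only [shape, if_pos (show n + 1 ≤ M by omega), if_pos (show n ≤ M by omega),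
      if_neg (show ¬ n + 2 ≤ M by omega), if_pos (show n + 1 = M ∨ n = M by omega)]
    split_ifs <;> first | omega | field_simp
  · rw [if_neg (by omega)] at hv
    subst hv
    simp only [shape, if_neg (show ¬ n + 1 ≤ M by omega), if_neg (show ¬ n + 2 ≤ M by omega)]
    split_ifs <;> first | omega | field_simp

lemma lequiv_nAsym_mul_wAsym (M N : ℕ) (hN : 1 ≤ N) {q : ℂ} (hq : q ≠ 0) (n : ℕ)
    (hn : n + 1 ≤ M + N - 1) (a : ℂ) {c d : ℂ} (hc : c ≠ 0) (hd : d ≠ 0) :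
    lequiv M N (nAsym M N q (n + 1) c a * wAsym M N q (n + 1) d a * (Amat M N q (n + 1) a)⁻¹)
      (wAsym M N q (n + 1) (d * (qq M q (n + 1))⁻¹) (a * (qq M q (n + 1) ^ 2)⁻¹) *
        ∏ j ∈ nbr M N (n + 1),
          wAsym M N q j ((c ^ alphaPair M (n + 1) j)⁻¹ * (q ^ alphaPair M (n + 1) j)⁻¹)
            (a * (q ^ alphaPair M (n + 1) j)⁻¹)) := by
  set t := a * (tau M N q (n + 1))⁻¹ with ht
  have hq1 := qq_ne_zero hq M (n + 1)
  have hq2 := qq_ne_zero hq M (n + 2)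
  have hh := qhat_ne_zero hq M (n + 1)
  have ht1 := tau_ne_zero hq M N (n + 1)
  have ht2 := tau_ne_zero hq M N (n + 2)
  refine lequiv_of_eqUpToConst t
    (if n + 1 = M ∨ n = M then t * (qq M q (n + 1) ^ 2)⁻¹ else t) fun k hk hk' => ?_
  have hself : EqUpToConst
      (((wAsym M N q (n + 1) (qhat M q (n + 1)) (a * qhat M q (n + 1) ^ 2)).1 k *
        (wAsym M N q (n + 1) d a).1 k) *
        ((wAsym M N q (n + 1) (d * (qq M q (n + 1))⁻¹) (a * (qq M q (n + 1) ^ 2)⁻¹)).1 k)⁻¹)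
      (shape M N (n + 1) k
        (lin (t * (qq M q (n + 1) ^ 2)⁻¹) / lin (t * qhat M q (n + 1) ^ 2))) := by
    have h1 := wAsym_fst_eqUpToConst M N q (n + 1) hh (a * qhat M q (n + 1) ^ 2) k
    have h2 := wAsym_div_wAsym_eqUpToConst M N q (n + 1) (a := a)
      (a' := a * (qq M q (n + 1) ^ 2)⁻¹) hd (mul_ne_zero hd (inv_ne_zero hq1))
      (by field_simp) k
    rw [mul_assoc]
    convert h1.mul h2 using 1
    rw [mul_inv_cancel_right₀ (pow_ne_zero 2 hh), shape_div, shape_div, Psi_fst, Psi_fst,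
      mul_right_comm a (qq M q (n + 1) ^ 2)⁻¹, mul_right_comm a (qhat M q (n + 1) ^ 2), ← ht,
      mul_comm (shape M N (n + 1) k (lin t)), mul_mul_mul_comm,
      mul_inv_cancel₀ (shape_ne_zero M N (n + 1) k (lin_ne_zero t)), mul_one, mul_comm]
  have hnbr : EqUpToConst
      (∏ j ∈ nbr M N (n + 1),
        ((wAsym M N q j ((c ^ alphaPair M (n + 1) j)⁻¹) (a * q ^ alphaPair M (n + 1) j)).1 k *
        ((wAsym M N q j ((c ^ alphaPair M (n + 1) j)⁻¹ * (q ^ alphaPair M (n + 1) j)⁻¹)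
            (a * (q ^ alphaPair M (n + 1) j)⁻¹)).1 k)⁻¹))
      (shape M N n k (lin t / lin (t * (qq M q (n + 1) ^ 2)⁻¹)) *
        shape M N (n + 2) k (lin (t * qq M q (n + 2) ^ 2) / lin t)) := by
    have h1 := EqUpToConst.prod (nbr M N (n + 1)) fun j _ =>
      wAsym_div_wAsym_eqUpToConst M N q j (c := (c ^ alphaPair M (n + 1) j)⁻¹)
        (c' := (c ^ alphaPair M (n + 1) j)⁻¹ * (q ^ alphaPair M (n + 1) j)⁻¹)
        (a := a * q ^ alphaPair M (n + 1) j) (a' := a * (q ^ alphaPair M (n + 1) j)⁻¹)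
        (inv_ne_zero (zpow_ne_zero _ hc))
        (mul_ne_zero (inv_ne_zero (zpow_ne_zero _ hc)) (inv_ne_zero (zpow_ne_zero _ hq)))
        (by
          have := zpow_ne_zero (alphaPair M (n + 1) j) hc
          have := zpow_ne_zero (alphaPair M (n + 1) j) hq
          generalize c ^ alphaPair M (n + 1) j = C at *
          generalize q ^ alphaPair M (n + 1) j = Q at *
          field_simp) k
    convert h1 using 1
    rw [prod_nbr_succ hn]
    · congr 2
      · rw [alphaPair_succ_self, zpow_neg_sgn, tau_eq_tau_succ_mul hq M N n]
        congr 2 <;> (rw [ht]; field_simp)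
      · rw [alphaPair_self_succ, zpow_neg_sgn]
        rw [tau_eq_tau_succ_mul hq M N (n + 1)] at ht
        congr 2 <;> (rw [ht]; field_simp)
    · simp only [shape]; split_ifs <;> first | rfl | omega
    · simp only [shape]; split_ifs <;> first | rfl | omega
  have key := (hself.mul hnbr).mul (Amat_fst_eqUpToConst M N hq (n + 1) a k).inv
  rw [← ht, shape_mul_shape_mul_shape hk hk' (lin_ne_zero _) (lin_ne_zero _) (lin_ne_zero _)
    ?_ ?_] at key
  · convert key using 1
    · simp only [nAsym, Prod.fst_mul, Prod.fst_inv, Prod.fst_prod, Pi.mul_apply, Pi.inv_apply,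
        Finset.prod_apply, Finset.prod_mul_distrib, Finset.prod_inv_distrib, mul_inv]
      ring
    · split_ifs
      · rfl
      · exact div_self (lin_ne_zero _)
  · unfold qhat qq
    split_ifs <;> first | omega | simp
  · intro h
    unfold qq
    rw [if_neg (by omega), if_pos (by omega), inv_pow]

/-- `𝔫^{(i)}_{c,a} 𝔴^{(i)}_{d,a} A_{i,a}⁻¹ ≡
𝔴^{(i)}_{dq_i⁻¹, aq_i⁻²} ∏_{j∼i} 𝔴^{(j)}_{c_{ij}⁻¹ q_{ij}⁻¹, aq_{ij}⁻¹}`. -/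
theorem statement15 (M N : ℕ) (hM : 1 ≤ M) (hN : 1 ≤ N) (q : ℂ) (hq : q ≠ 0)
    (hroot : ∀ n : ℕ, 0 < n → q ^ n ≠ 1) (i : ℕ) (hi : 1 ≤ i) (hi' : i ≤ M + N - 1)
    (a c d : ℂ) (ha : a ≠ 0) (hc : c ≠ 0) (hd : d ≠ 0) :
    lequiv M N (nAsym M N q i c a * wAsym M N q i d a * (Amat M N q i a)⁻¹)
      (wAsym M N q i (d * (qq M q i)⁻¹) (a * (qq M q i ^ 2)⁻¹) *
        ∏ j ∈ nbr M N i,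
          wAsym M N q j ((c ^ alphaPair M i j)⁻¹ * (q ^ alphaPair M i j)⁻¹)
            (a * (q ^ alphaPair M i j)⁻¹)) := by
  obtain ⟨n, rfl⟩ := Nat.exists_eq_add_of_le' hi
  exact lequiv_nAsym_mul_wAsym M N hN hq n hi' a hc hd

end QAS
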